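/- (Small-gain estimate.) Let U and X be normed spaces, β ∈ ℝ, u : [0,∞) → U continuous, and x : [0,∞) → X. Suppose there are constants α ∈ [0,1), b ≥ 0, α′ ≥ 0, b′ ≥ 0 such that for all t ≥ 0: e^{βt}·‖u(t)‖ ≤ α·sup_{s∈[0,t]} e^{βs}·‖u(s)‖ + b, and e^{βt}·‖x(t)‖ ≤ α′·sup_{s∈[0,t]} e^{βs}·‖u(s)‖ + b′. Then for all t ≥ 0: e^{βt}·‖x(t)‖ ≤ α′·b/(1−α) + b′. In particular, if β > 0 then ‖x(t)‖ decays exponentially. -/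

import Mathlib

/-- If a continuous function `f` on `[0,∞)` satisfies `f t ≤ α * sup_{[0,t]} f + b` with
`0 ≤ α < 1`, then its running supremum is bounded by `b / (1 - α)`. -/
theorem iSup_Icc_le_div_of_le_mul_iSup_add {f : ℝ → ℝ} (hf : ContinuousOn f (Set.Ici 0))
    {α b : ℝ} (hα0 : 0 ≤ α) (hα1 : α < 1)
    (h : ∀ t : ℝ, 0 ≤ t → f t ≤ α * (⨆ s : Set.Icc (0:ℝ) t, f s) + b) {t : ℝ} (ht : 0 ≤ t) :
    (⨆ s : Set.Icc (0:ℝ) t, f s) ≤ b / (1 - α) := by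
  have hbdd : BddAbove (Set.range fun s : Set.Icc (0:ℝ) t => f s) := by
    rw [Set.range_comp' f Subtype.val, Subtype.range_coe]
    exact isCompact_Icc.bddAbove_image (hf.mono Set.Icc_subset_Ici_self)
  have hself : (⨆ s : Set.Icc (0:ℝ) t, f s) ≤ α * (⨆ s : Set.Icc (0:ℝ) t, f s) + b := by
    have : Nonempty (Set.Icc (0:ℝ) t) := ⟨⟨0, le_rfl, ht⟩⟩
    refine ciSup_le fun ⟨s, hs0, hst⟩ => (h s hs0).trans ?_
    have : Nonempty (Set.Icc (0:ℝ) s) := ⟨⟨0, le_rfl, hs0⟩⟩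
    gcongr
    exact ciSup_le fun r => le_ciSup hbdd ⟨r, r.2.1, r.2.2.trans hst⟩
  rw [le_div_iff₀ (sub_pos.2 hα1)]
  linarith

open Set in
/-- **small-gain estimate.**
Let `U`, `X` be normed spaces, `β ∈ ℝ`, `u : [0,∞) → U` continuous, `x : [0,∞) → X`.
If `e^{βt} ‖u t‖ ≤ α * sup_{s ∈ [0,t]} e^{βs} ‖u s‖ + b` with `0 ≤ α < 1` and
`e^{βt} ‖x t‖ ≤ α' * sup_{s ∈ [0,t]} e^{βs} ‖u s‖ + b'` for all `t ≥ 0`,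
then `e^{βt} ‖x t‖ ≤ α' * b / (1 - α) + b'` for all `t ≥ 0`. -/
theorem small_gain_estimate
    {U : Type*} [NormedAddCommGroup U] [NormedSpace ℂ U]
    {X : Type*} [NormedAddCommGroup X] [NormedSpace ℂ X]
    (β : ℝ) (u : ℝ → U) (hu : ContinuousOn u (Ici 0)) (x : ℝ → X)
    (α b α' b' : ℝ) (hα0 : 0 ≤ α) (hα1 : α < 1) (hb : 0 ≤ b) (hα' : 0 ≤ α') (hb' : 0 ≤ b')
    (hgain : ∀ t : ℝ, 0 ≤ t →
      Real.exp (β * t) * ‖u t‖ ≤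
        α * (⨆ s : Icc (0:ℝ) t, Real.exp (β * (s : ℝ)) * ‖u (s : ℝ)‖) + b)
    (hstate : ∀ t : ℝ, 0 ≤ t →
      Real.exp (β * t) * ‖x t‖ ≤
        α' * (⨆ s : Icc (0:ℝ) t, Real.exp (β * (s : ℝ)) * ‖u (s : ℝ)‖) + b') :
    ∀ t : ℝ, 0 ≤ t → Real.exp (β * t) * ‖x t‖ ≤ α' * b / (1 - α) + b' := by
  intro t ht
  have hf : ContinuousOn (fun s : ℝ => Real.exp (β * s) * ‖u s‖) (Ici 0) := by fun_prop
  have hsup := iSup_Icc_le_div_of_le_mul_iSup_add hf hα0 hα1 hgain ht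
  rw [mul_div_assoc]
  exact (hstate t ht).trans (by gcongr)
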